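/- arXiv:2306.11625 — 4 statements merged into one kernel-verified Lean document; each statement's English description precedes it below -/
import Mathlib

section
/- For every y > 0, coth(y) − 1/y ≤ y/3. -/
/-- The hyperbolic cotangent `coth y = cosh y / sinh y`. -/
noncomputable def coth (y : ℝ) : ℝ := Real.cosh y / Real.sinh y

theorem Real.sinh_le_self_mul_cosh {y : ℝ} (hy : 0 ≤ y) :
    Real.sinh y ≤ y * Real.cosh y := by
  have hd (x : ℝ) : HasDerivAt (fun x => x * Real.cosh x - Real.sinh x) (x * Real.sinh x) x := by
    refine (((hasDerivAt_id' x).mul (Real.hasDerivAt_cosh x)).sub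
      (Real.hasDerivAt_sinh x)).congr_deriv ?_
    ring
  have hmono : MonotoneOn (fun x => x * Real.cosh x - Real.sinh x) (Set.Ici 0) := by
    refine monotoneOn_of_deriv_nonneg (convex_Ici 0)
      (fun x _ => (hd x).continuousAt.continuousWithinAt)
      (fun x _ => (hd x).differentiableAt.differentiableWithinAt) fun x hx => ?_
    rw [(hd x).deriv]
    have hx : 0 ≤ x := interior_subset hx
    exact mul_nonneg hx (Real.sinh_nonneg_iff.2 hx)
  simpa using hmono Set.self_mem_Ici hy hy

theorem Real.three_mul_self_mul_cosh_le {y : ℝ} (hy : 0 ≤ y) :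
    3 * y * Real.cosh y ≤ (3 + y ^ 2) * Real.sinh y := by
  have hd (x : ℝ) : HasDerivAt (fun x => (3 + x ^ 2) * Real.sinh x - 3 * x * Real.cosh x)
      (x * (x * Real.cosh x - Real.sinh x)) x := by
    refine ((((hasDerivAt_pow 2 x).const_add 3).mul (Real.hasDerivAt_sinh x)).sub
      (((hasDerivAt_id' x).const_mul 3).mul (Real.hasDerivAt_cosh x))).congr_deriv ?_
    push_cast
    ring
  have hmono : MonotoneOn (fun x => (3 + x ^ 2) * Real.sinh x - 3 * x * Real.cosh x)
      (Set.Ici 0) := by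
    refine monotoneOn_of_deriv_nonneg (convex_Ici 0)
      (fun x _ => (hd x).continuousAt.continuousWithinAt)
      (fun x _ => (hd x).differentiableAt.differentiableWithinAt) fun x hx => ?_
    rw [(hd x).deriv]
    have hx : 0 ≤ x := interior_subset hx
    exact mul_nonneg hx (sub_nonneg.2 (Real.sinh_le_self_mul_cosh hx))
  simpa using hmono Set.self_mem_Ici hy hy

/-- For every `y > 0`, `coth(y) − 1/y ≤ y/3`. -/
theorem coth_sub_inv_le (y : ℝ) (hy : 0 < y) : coth y - 1 / y ≤ y / 3 := by
  have hs : 0 < Real.sinh y := Real.sinh_pos_iff.2 hy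
  have h := Real.three_mul_self_mul_cosh_le hy.le
  have heq : y / 3 + 1 / y = (3 + y ^ 2) / (3 * y) := by
    field_simp
    ring
  rw [sub_le_iff_le_add, coth, heq, div_le_div_iff₀ hs (by positivity)]
  linarith
end

section
/- For every β > 0, the matrix-valued function F̃ tends to (β/3)·I₃ as ξ → 0 in ℝ³ \ {0}; that is, every entry of F̃(ξ) converges to the corresponding entry of (β/3)·I₃ as ‖ξ‖ → 0. -/
open MeasureTheory Filter Matrix
open scoped Topology

/-- The dilated Langevin function `L_β`: `L_β z = coth (β z) - 1/(β z)` for `z ≠ 0`, `L_β 0 = 0`. -/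
noncomputable def Lb (β z : ℝ) : ℝ := if z = 0 then 0 else coth (β * z) - 1 / (β * z)

/-- `L'_β z = 1/(β z²) - β/(sinh (β z))²` (the derivative of `L_β` away from `0`). -/
noncomputable def Lb' (β z : ℝ) : ℝ := 1 / (β * z ^ 2) - β / (Real.sinh (β * z)) ^ 2

/-- The Euclidean norm on `ℝ³`. -/
noncomputable def enorm3 (ξ : Fin 3 → ℝ) : ℝ := Real.sqrt (∑ i, ξ i ^ 2)

/-- The matrix `F̃(ξ) = (L'_β(‖ξ‖)/‖ξ‖² − L_β(‖ξ‖)/‖ξ‖³)·ξξᵀ + (L_β(‖ξ‖)/‖ξ‖)·I₃` for `ξ ≠ 0`,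
extended to `ξ = 0` by `(β/3)·I₃`. -/
noncomputable def Ftilde (β : ℝ) (ξ : Fin 3 → ℝ) : Matrix (Fin 3) (Fin 3) ℝ :=
  if ξ = 0 then (β / 3) • (1 : Matrix (Fin 3) (Fin 3) ℝ)
  else (Lb' β (enorm3 ξ) / (enorm3 ξ) ^ 2 - Lb β (enorm3 ξ) / (enorm3 ξ) ^ 3) •
        Matrix.of (fun i j => ξ i * ξ j)
      + (Lb β (enorm3 ξ) / enorm3 ξ) • (1 : Matrix (Fin 3) (Fin 3) ℝ)

theorem tendsto_sinh_div_self_zero :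
    Tendsto (fun y : ℝ => Real.sinh y / y) (𝓝[≠] 0) (𝓝 1) := by
  have h := (Real.hasDerivAt_sinh 0).tendsto_slope_zero
  simpa [div_eq_inv_mul] using h

theorem tendsto_cosh_sub_one_div_sq_zero :
    Tendsto (fun y : ℝ => (Real.cosh y - 1) / y ^ 2) (𝓝[≠] 0) (𝓝 (1 / 2)) := by
  refine HasDerivAt.lhopital_zero_nhdsNE (f' := Real.sinh) (g' := fun y => 2 * y)
    (Eventually.of_forall fun y => (Real.hasDerivAt_cosh y).sub_const 1)
    (Eventually.of_forall fun y => by simpa using hasDerivAt_pow 2 y)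
    (eventually_mem_nhdsWithin.mono fun y hy => mul_ne_zero two_ne_zero hy) ?_ ?_ ?_
  · have h : Continuous fun y : ℝ => Real.cosh y - 1 := by fun_prop
    simpa using (h.tendsto 0).mono_left nhdsWithin_le_nhds
  · have h : Continuous fun y : ℝ => y ^ 2 := by fun_prop
    simpa using (h.tendsto 0).mono_left nhdsWithin_le_nhds
  · refine (tendsto_sinh_div_self_zero.div_const 2).congr fun y => ?_
    rw [div_div, mul_comm]

theorem tendsto_sinh_sub_self_div_cube_zero :
    Tendsto (fun y : ℝ => (Real.sinh y - y) / y ^ 3) (𝓝[≠] 0) (𝓝 (1 / 6)) := by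
  refine HasDerivAt.lhopital_zero_nhdsNE (f' := fun y => Real.cosh y - 1)
    (g' := fun y => 3 * y ^ 2)
    (Eventually.of_forall fun y => (Real.hasDerivAt_sinh y).sub (hasDerivAt_id y))
    (Eventually.of_forall fun y => by simpa using hasDerivAt_pow 3 y)
    (eventually_mem_nhdsWithin.mono fun y hy => mul_ne_zero three_ne_zero (pow_ne_zero 2 hy))
    ?_ ?_ ?_
  · have h : Continuous fun y : ℝ => Real.sinh y - y := by fun_prop
    simpa using (h.tendsto 0).mono_left nhdsWithin_le_nhds
  · have h : Continuous fun y : ℝ => y ^ 3 := by fun_prop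
    simpa using (h.tendsto 0).mono_left nhdsWithin_le_nhds
  · have h := tendsto_cosh_sub_one_div_sq_zero.div_const 3
    norm_num at h ⊢
    refine h.congr fun y => ?_
    rw [div_div, mul_comm]

theorem tendsto_self_mul_cosh_sub_sinh_div_cube_zero :
    Tendsto (fun y : ℝ => (y * Real.cosh y - Real.sinh y) / y ^ 3) (𝓝[≠] 0) (𝓝 (1 / 3)) := by
  have h := tendsto_cosh_sub_one_div_sq_zero.sub tendsto_sinh_sub_self_div_cube_zero
  norm_num at h ⊢
  refine h.congr' (eventually_mem_nhdsWithin.mono fun y hy => ?_)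
  have hy : y ≠ 0 := hy
  field_simp
  ring

theorem tendsto_const_mul_nhdsNE_zero {β : ℝ} (hβ : β ≠ 0) :
    Tendsto (fun z : ℝ => β * z) (𝓝[≠] 0) (𝓝[≠] 0) := by
  refine tendsto_nhdsWithin_iff.2
    ⟨?_, eventually_mem_nhdsWithin.mono fun z hz => mul_ne_zero hβ hz⟩
  simpa using ((continuous_const_mul β).tendsto 0).mono_left nhdsWithin_le_nhds

theorem tendsto_Lb_div_self_zero {β : ℝ} (hβ : β ≠ 0) :
    Tendsto (fun z => Lb β z / z) (𝓝[≠] 0) (𝓝 (β / 3)) := by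
  have h := ((tendsto_self_mul_cosh_sub_sinh_div_cube_zero.div
    tendsto_sinh_div_self_zero one_ne_zero).const_mul β).comp (tendsto_const_mul_nhdsNE_zero hβ)
  rw [show β * (1 / 3 / 1) = β / 3 by ring] at h
  refine h.congr' (eventually_mem_nhdsWithin.mono fun z hz => ?_)
  have hz : z ≠ 0 := hz
  have hs : Real.sinh (β * z) ≠ 0 := by simp [hβ, hz]
  simp only [Function.comp_apply, Pi.div_apply, Lb, coth, if_neg hz]
  field_simp

theorem tendsto_Lb'_zero {β : ℝ} (hβ : β ≠ 0) :
    Tendsto (Lb' β) (𝓝[≠] 0) (𝓝 (β / 3)) := by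
  have h := (((tendsto_sinh_sub_self_div_cube_zero.mul
    (tendsto_sinh_div_self_zero.add_const 1)).div (tendsto_sinh_div_self_zero.pow 2)
    (by norm_num)).const_mul β).comp (tendsto_const_mul_nhdsNE_zero hβ)
  rw [show β * (1 / 6 * (1 + 1) / 1 ^ 2) = β / 3 by ring] at h
  refine h.congr' (eventually_mem_nhdsWithin.mono fun z hz => ?_)
  have hz : z ≠ 0 := hz
  have hs : Real.sinh (β * z) ≠ 0 := by simp [hβ, hz]
  simp only [Function.comp_apply, Pi.div_apply, Lb']
  field_simp
  ring

theorem abs_apply_le_enorm3 (ξ : Fin 3 → ℝ) (i : Fin 3) : |ξ i| ≤ enorm3 ξ :=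
  Real.abs_le_sqrt (Finset.single_le_sum (f := fun k => ξ k ^ 2)
    (fun k _ => sq_nonneg (ξ k)) (Finset.mem_univ i))

theorem enorm3_ne_zero {ξ : Fin 3 → ℝ} (hξ : ξ ≠ 0) : enorm3 ξ ≠ 0 := fun h =>
  hξ (funext fun i => abs_nonpos_iff.1 (h ▸ abs_apply_le_enorm3 ξ i))

theorem tendsto_enorm3_nhdsNE_zero : Tendsto enorm3 (𝓝[≠] 0) (𝓝[≠] 0) := by
  refine tendsto_nhdsWithin_iff.2
    ⟨?_, eventually_mem_nhdsWithin.mono fun ξ hξ => enorm3_ne_zero hξ⟩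
  have h : Continuous enorm3 := by unfold enorm3; fun_prop
  simpa [enorm3] using (h.tendsto 0).mono_left nhdsWithin_le_nhds

theorem abs_mul_div_enorm3_sq_le_one (ξ : Fin 3 → ℝ) (i j : Fin 3) :
    |ξ i * ξ j / enorm3 ξ ^ 2| ≤ 1 := by
  rw [abs_div, abs_mul, abs_of_nonneg (sq_nonneg (enorm3 ξ)), sq]
  exact div_le_one_of_le₀ (mul_le_mul (abs_apply_le_enorm3 ξ i) (abs_apply_le_enorm3 ξ j)
    (abs_nonneg _) (Real.sqrt_nonneg _)) (mul_self_nonneg _)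

/-- For every `β > 0`, every entry of `F̃(ξ)` converges to the corresponding entry of
`(β/3)·I₃` as `ξ → 0` within `ℝ³ \ {0}`. -/
theorem Ftilde_tendsto_at_zero (β : ℝ) (hβ : 0 < β) (i j : Fin 3) :
    Tendsto (fun ξ : Fin 3 → ℝ => Ftilde β ξ i j) (𝓝[≠] 0)
      (𝓝 (((β / 3) • (1 : Matrix (Fin 3) (Fin 3) ℝ)) i j)) := by
  have hL := (tendsto_Lb_div_self_zero hβ.ne').comp tendsto_enorm3_nhdsNE_zero
  have hL' := (tendsto_Lb'_zero hβ.ne').comp tendsto_enorm3_nhdsNE_zero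
  have hdiff := hL'.sub hL
  rw [sub_self] at hdiff
  have hrank := bdd_le_mul_tendsto_zero' 1
    (Eventually.of_forall fun ξ => abs_mul_div_enorm3_sq_le_one ξ i j) hdiff
  have h := hrank.add (hL.mul_const ((1 : Matrix (Fin 3) (Fin 3) ℝ) i j))
  rw [zero_add] at h
  refine h.congr' (eventually_mem_nhdsWithin.mono fun ξ hξ => ?_)
  have hξ : ξ ≠ 0 := hξ
  have hr := enorm3_ne_zero hξ
  simp only [Function.comp_apply, Ftilde, if_neg hξ, Matrix.add_apply, Matrix.smul_apply,
    Matrix.of_apply, smul_eq_mul]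
  field_simp
end

section
/- (Positive definiteness) For every β > 0 and every ξ ∈ ℝ³ \ {0}, the matrix F̃(ξ) is positive definite: for every x ∈ ℝ³ with x ≠ 0, one has xᵀ F̃(ξ) x > 0. -/
open MeasureTheory Filter Matrix
open scoped Topology

/-- The inequality `tanh y < y` for `y > 0`, cleared of denominators. -/
theorem sinh_lt_self_mul_cosh {y : ℝ} (hy : 0 < y) : Real.sinh y < y * Real.cosh y := by
  have hd (t : ℝ) : HasDerivAt (fun t => t * Real.cosh t - Real.sinh t) (t * Real.sinh t) t := by
    refine (((hasDerivAt_id t).mul (Real.hasDerivAt_cosh t)).sub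
      (Real.hasDerivAt_sinh t)).congr_deriv ?_
    simp only [id_eq]
    ring
  have hmono : StrictMonoOn (fun t => t * Real.cosh t - Real.sinh t) (Set.Ici 0) := by
    refine strictMonoOn_of_deriv_pos (convex_Ici 0)
      (fun t _ => (hd t).continuousAt.continuousWithinAt) fun t ht => ?_
    rw [interior_Ici, Set.mem_Ioi] at ht
    rw [(hd t).deriv]
    exact mul_pos ht (Real.sinh_pos_iff.2 ht)
  have h := hmono Set.self_mem_Ici hy.le hy
  simp only [zero_mul, Real.sinh_zero, sub_zero] at h
  linarith

theorem Lb_pos {β z : ℝ} (hβ : 0 < β) (hz : 0 < z) : 0 < Lb β z := by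
  have hy : 0 < β * z := mul_pos hβ hz
  rw [Lb, if_neg hz.ne', coth, sub_pos, div_lt_div_iff₀ hy (Real.sinh_pos_iff.2 hy)]
  linarith [sinh_lt_self_mul_cosh hy]

theorem Lb'_pos {β z : ℝ} (hβ : 0 < β) (hz : 0 < z) : 0 < Lb' β z := by
  have hy : 0 < β * z := mul_pos hβ hz
  have hsq : (β * z) ^ 2 < Real.sinh (β * z) ^ 2 :=
    pow_lt_pow_left₀ (Real.self_lt_sinh_iff.2 hy) hy.le two_ne_zero
  rw [Lb', sub_pos, div_lt_div_iff₀ (pow_pos (Real.sinh_pos_iff.2 hy) 2) (by positivity)]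
  linarith

theorem enorm3_pos {ξ : Fin 3 → ℝ} (hξ : ξ ≠ 0) : 0 < enorm3 ξ := by
  obtain ⟨i, hi⟩ := Function.ne_iff.1 hξ
  exact Real.sqrt_pos.2 <| Finset.sum_pos' (fun j _ => sq_nonneg (ξ j))
    ⟨i, Finset.mem_univ i, sq_pos_of_ne_zero hi⟩

theorem enorm3_sq (ξ : Fin 3 → ℝ) : enorm3 ξ ^ 2 = ∑ i, ξ i ^ 2 :=
  Real.sq_sqrt (Finset.sum_nonneg fun i _ => sq_nonneg (ξ i))

theorem dotProduct_sq_le_enorm3 (ξ x : Fin 3 → ℝ) :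
    (ξ ⬝ᵥ x) ^ 2 ≤ enorm3 ξ ^ 2 * enorm3 x ^ 2 := by
  rw [enorm3_sq, enorm3_sq]
  exact Finset.sum_mul_sq_le_sq_mul_sq Finset.univ ξ x

theorem dotProduct_Ftilde_mulVec {ξ : Fin 3 → ℝ} (β : ℝ) (hξ : ξ ≠ 0) (x : Fin 3 → ℝ) :
    x ⬝ᵥ (Ftilde β ξ).mulVec x =
      Lb' β (enorm3 ξ) / enorm3 ξ ^ 2 * (ξ ⬝ᵥ x) ^ 2 +
        Lb β (enorm3 ξ) / enorm3 ξ ^ 3 * (enorm3 ξ ^ 2 * enorm3 x ^ 2 - (ξ ⬝ᵥ x) ^ 2) := by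
  have hr := (enorm3_pos hξ).ne'
  have hL : Lb β (enorm3 ξ) / enorm3 ξ ^ 3 * enorm3 ξ ^ 2 = Lb β (enorm3 ξ) / enorm3 ξ := by
    field_simp
  have houter : Matrix.of (fun i j => ξ i * ξ j) = Matrix.vecMulVec ξ ξ := rfl
  have hx : x ⬝ᵥ x = enorm3 x ^ 2 := by
    rw [enorm3_sq]
    simp only [dotProduct, sq]
  rw [Ftilde, if_neg hξ, houter, Matrix.add_mulVec, Matrix.smul_mulVec, Matrix.smul_mulVec,
    Matrix.one_mulVec, Matrix.vecMulVec_mulVec, dotProduct_add, dotProduct_smul, dotProduct_smul,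
    op_smul_eq_smul, dotProduct_smul, hx, dotProduct_comm x ξ, mul_sub, ← mul_assoc, hL]
  simp only [smul_eq_mul]
  ring

/-- Positive definiteness: for every `β > 0` and `ξ ≠ 0`, the matrix `F̃(ξ)` is positive
definite: `xᵀ F̃(ξ) x > 0` for every `x ≠ 0`. -/
theorem Ftilde_posDef (β : ℝ) (hβ : 0 < β) (ξ : Fin 3 → ℝ) (hξ : ξ ≠ 0)
    (x : Fin 3 → ℝ) (hx : x ≠ 0) :
    0 < x ⬝ᵥ (Ftilde β ξ).mulVec x := by
  have hr := enorm3_pos hξ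
  have hL := Lb_pos hβ hr
  have hL' := Lb'_pos hβ hr
  have hxpos := enorm3_pos hx
  rw [dotProduct_Ftilde_mulVec β hξ]
  by_cases hs : ξ ⬝ᵥ x = 0
  · rw [hs]
    simp only [ne_eq, OfNat.ofNat_ne_zero, not_false_eq_true, zero_pow, mul_zero, zero_add,
      sub_zero]
    positivity
  · exact add_pos_of_pos_of_nonneg (by positivity)
      (mul_nonneg (by positivity) (sub_nonneg.2 (dotProduct_sq_le_enorm3 ξ x)))
end

section
/- (Mixed-norm kernel compactness) Let (Ω, μ) and (I, ν) be finite measure spaces, let 1 < l < ∞ with conjugate exponent l* (1/l + 1/l* = 1), and let k : Ω × I → ℝ be measurable with ∫_I (∫_Ω |k(x,t)|^{l*} dμ(x))^{2/l*} dν(t) < ∞. Then every continuous linear operator A : L^l(μ) → L²(ν) satisfying, for every c ∈ L^l(μ), (A c)(t) = ∫_Ω k(x,t) c(x) dμ(x) for ν-almost every t, is a compact operator. -/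
open MeasureTheory

section MixedNorm

open Filter Topology ENNReal

variable {α γ : Type*} [MeasurableSpace α] [MeasurableSpace γ]

/-- The mixed norm of a kernel `f`: the `L²(ν)`-norm of `t ↦ ‖f (·, t)‖_{L^p(μ)}`. -/
noncomputable def mixedNorm (p : ℝ≥0∞) (μ : Measure α) (ν : Measure γ) (f : α × γ → ℝ) : ℝ≥0∞ :=
  eLpNorm (fun t => eLpNorm (fun x => f (x, t)) p μ) 2 ν

/-- The span of the indicators of measurable rectangles. -/
def rectangleSpan (α γ : Type*) [MeasurableSpace α] [MeasurableSpace γ] :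
    Submodule ℝ (α × γ → ℝ) :=
  Submodule.span ℝ {f | ∃ s : Set α, ∃ t : Set γ, MeasurableSet s ∧ MeasurableSet t ∧
    f = (s ×ˢ t).indicator fun _ => 1}

/-- `f` is a limit, in mixed norm, of elements of `rectangleSpan α γ`. -/
def MixedApproximable (p : ℝ≥0∞) (μ : Measure α) (ν : Measure γ) (f : α × γ → ℝ) : Prop :=
  ∀ ε : ℝ≥0∞, 0 < ε → ∃ g ∈ rectangleSpan α γ, mixedNorm p μ ν (f - g) ≤ ε

lemma measurable_of_mem_rectangleSpan {g : α × γ → ℝ} (hg : g ∈ rectangleSpan α γ) :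
    Measurable g := by
  induction hg using Submodule.span_induction with
  | mem f hf =>
    obtain ⟨s, t, hs, ht, rfl⟩ := hf
    exact measurable_const.indicator (hs.prod ht)
  | zero => exact measurable_zero
  | add f g _ _ hf hg => exact hf.add hg
  | smul c f _ hf => exact hf.const_smul c

section

variable {p : ℝ≥0∞} {μ : Measure α} {ν : Measure γ}

lemma measurable_eLpNorm_section [SFinite μ] (hp0 : p ≠ 0) (hp : p ≠ ∞) {f : α × γ → ℝ}
    (hf : Measurable f) : Measurable fun t => eLpNorm (fun x => f (x, t)) p μ := by
  simp only [eLpNorm_eq_lintegral_rpow_enorm_toReal hp0 hp]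
  exact (Measurable.lintegral_prod_left' (hf.enorm.pow_const _)).pow_const _

lemma mixedNorm_zero : mixedNorm p μ ν 0 = 0 := by
  have : (fun t : γ => eLpNorm (fun x : α => (0 : α × γ → ℝ) (x, t)) p μ) = fun _ => 0 := by
    funext t
    exact eLpNorm_zero
  rw [mixedNorm, this]
  exact eLpNorm_zero'

lemma mixedNorm_add_le [SFinite μ] (hp1 : 1 ≤ p) (hp : p ≠ ∞) {f g : α × γ → ℝ}
    (hf : Measurable f) (hg : Measurable g) :
    mixedNorm p μ ν (f + g) ≤ mixedNorm p μ ν f + mixedNorm p μ ν g := by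
  have hp0 : p ≠ 0 := (zero_lt_one.trans_le hp1).ne'
  refine le_trans (eLpNorm_mono_enorm fun t => ?_) (eLpNorm_add_le
    (measurable_eLpNorm_section hp0 hp hf).aestronglyMeasurable
    (measurable_eLpNorm_section hp0 hp hg).aestronglyMeasurable one_le_two)
  exact eLpNorm_add_le (hf.comp measurable_prodMk_right).aestronglyMeasurable
    (hg.comp measurable_prodMk_right).aestronglyMeasurable hp1

lemma mixedNorm_const_smul_le (c : ℝ) (f : α × γ → ℝ) :
    mixedNorm p μ ν (c • f) ≤ ‖c‖ₑ * mixedNorm p μ ν f := by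
  have h : ∀ t, ‖eLpNorm (fun x => (c • f) (x, t)) p μ‖ₑ
      ≤ ‖c‖₊ * ‖eLpNorm (fun x => f (x, t)) p μ‖ₑ := fun t =>
    (eLpNorm_const_smul c (fun x => f (x, t)) p μ).le
  exact eLpNorm_le_nnreal_smul_eLpNorm_of_ae_le_mul' (Eventually.of_forall h) 2

lemma mixedNorm_const_lt_top [IsFiniteMeasure μ] [IsFiniteMeasure ν] (c : ℝ) :
    mixedNorm p μ ν (fun _ => c) < ∞ := by
  have h : eLpNorm (fun _ : α => c) p μ ≠ ∞ := (memLp_const c).eLpNorm_ne_top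
  rw [mixedNorm]
  exact (memLp_const_enorm h).eLpNorm_lt_top

/-- Dominated convergence for the mixed norm. -/
lemma tendsto_mixedNorm_of_dominated [SFinite μ] (hp0 : p ≠ 0) (hp : p ≠ ∞)
    {f : ℕ → α × γ → ℝ} {F : α × γ → ℝ} (hf : ∀ n, Measurable (f n))
    (hF : mixedNorm p μ ν F < ∞) (hFm : Measurable F) (hle : ∀ n z, ‖f n z‖ ≤ ‖F z‖)
    (hlim : ∀ z, Tendsto (fun n => f n z) atTop (𝓝 0)) :
    Tendsto (fun n => mixedNorm p μ ν (f n)) atTop (𝓝 0) := by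
  have hpr : 0 < p.toReal := ENNReal.toReal_pos hp0 hp
  have key : ∀ t, eLpNorm (fun x => F (x, t)) p μ < ∞ →
      Tendsto (fun n => eLpNorm (fun x => f n (x, t)) p μ) atTop (𝓝 0) := by
    intro t ht
    simp only [eLpNorm_eq_lintegral_rpow_enorm_toReal hp0 hp]
    have := tendsto_lintegral_of_dominated_convergence (μ := μ)
      (F := fun n x => ‖f n (x, t)‖ₑ ^ p.toReal) (f := fun _ => 0)
      (fun x => ‖F (x, t)‖ₑ ^ p.toReal)
      (fun n => (((hf n).comp measurable_prodMk_right).enorm.pow_const _))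
      (fun n => Eventually.of_forall fun x => by
        have := enorm_le_iff_norm_le.2 (hle n (x, t))
        dsimp only
        gcongr)
      (lintegral_rpow_enorm_lt_top_of_eLpNorm_lt_top hp0 hp ht).ne
      (Eventually.of_forall fun x => by
        have := ((hlim (x, t)).enorm).ennrpow_const p.toReal
        simpa [hpr] using this)
    simpa [hpr] using this.ennrpow_const (1 / p.toReal)
  have hfin : ∀ᵐ t ∂ν, eLpNorm (fun x => F (x, t)) p μ < ∞ := by
    have h2 := lintegral_rpow_enorm_lt_top_of_eLpNorm_lt_top two_ne_zero ofNat_ne_top hF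
    filter_upwards [ae_lt_top
      (((measurable_eLpNorm_section hp0 hp hFm).enorm).pow_const _) h2.ne] with t ht
    by_contra hcon
    rw [not_lt_top_iff.1 hcon] at ht
    simp at ht
  simp only [mixedNorm, eLpNorm_eq_lintegral_rpow_enorm_toReal two_ne_zero ofNat_ne_top]
  have := tendsto_lintegral_of_dominated_convergence (μ := ν)
      (F := fun n t => ‖eLpNorm (fun x => f n (x, t)) p μ‖ₑ ^ (2 : ℝ≥0∞).toReal) (f := fun _ => 0)
      (fun t => ‖eLpNorm (fun x => F (x, t)) p μ‖ₑ ^ (2 : ℝ≥0∞).toReal)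
      (fun n => ((measurable_eLpNorm_section hp0 hp (hf n)).enorm.pow_const _))
      (fun n => Eventually.of_forall fun t => by
        have : eLpNorm (fun x => f n (x, t)) p μ ≤ eLpNorm (fun x => F (x, t)) p μ :=
          eLpNorm_mono fun x => hle n (x, t)
        simp only [enorm_eq_self]
        gcongr)
      (lintegral_rpow_enorm_lt_top_of_eLpNorm_lt_top two_ne_zero ofNat_ne_top hF).ne
      (by
        filter_upwards [hfin] with t ht
        simpa using (key t ht).ennrpow_const (2 : ℝ≥0∞).toReal)
  simpa using this.ennrpow_const (1 / (2 : ℝ≥0∞).toReal)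

namespace MixedApproximable

lemma of_mem {f : α × γ → ℝ} (hf : f ∈ rectangleSpan α γ) : MixedApproximable p μ ν f :=
  fun ε _ => ⟨f, hf, by simp [mixedNorm_zero]⟩

lemma add [SFinite μ] (hp1 : 1 ≤ p) (hp : p ≠ ∞) {f g : α × γ → ℝ}
    (hfm : Measurable f) (hgm : Measurable g) (hf : MixedApproximable p μ ν f)
    (hg : MixedApproximable p μ ν g) : MixedApproximable p μ ν (f + g) := by
  intro ε hε
  obtain ⟨f', hf', hf''⟩ := hf (ε / 2) (ENNReal.half_pos hε.ne')
  obtain ⟨g', hg', hg''⟩ := hg (ε / 2) (ENNReal.half_pos hε.ne')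
  refine ⟨f' + g', add_mem hf' hg', ?_⟩
  rw [add_sub_add_comm, ← ENNReal.add_halves ε]
  exact (mixedNorm_add_le hp1 hp (hfm.sub (measurable_of_mem_rectangleSpan hf'))
    (hgm.sub (measurable_of_mem_rectangleSpan hg'))).trans (add_le_add hf'' hg'')

lemma const_smul {f : α × γ → ℝ} (hf : MixedApproximable p μ ν f) (c : ℝ) :
    MixedApproximable p μ ν (c • f) := by
  intro ε hε
  obtain ⟨g, hg, hg'⟩ := hf (ε / ‖c‖ₑ) (ENNReal.div_pos hε.ne' enorm_ne_top)
  refine ⟨c • g, Submodule.smul_mem _ _ hg, ?_⟩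
  rw [← smul_sub]
  calc _ ≤ ‖c‖ₑ * mixedNorm p μ ν (f - g) := mixedNorm_const_smul_le _ _
    _ ≤ ‖c‖ₑ * (ε / ‖c‖ₑ) := by gcongr
    _ ≤ ε := ENNReal.mul_div_le

lemma of_dominated [SFinite μ] (hp1 : 1 ≤ p) (hp : p ≠ ∞) {f : ℕ → α × γ → ℝ}
    {f' F : α × γ → ℝ} (hf : ∀ n, Measurable (f n)) (hf' : Measurable f') (hFm : Measurable F)
    (hF : mixedNorm p μ ν F < ∞) (hle : ∀ n z, ‖f' z - f n z‖ ≤ ‖F z‖)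
    (hlim : ∀ z, Tendsto (fun n => f n z) atTop (𝓝 (f' z)))
    (h : ∀ n, MixedApproximable p μ ν (f n)) : MixedApproximable p μ ν f' := by
  intro ε hε
  have hp0 : p ≠ 0 := (zero_lt_one.trans_le hp1).ne'
  have hε2 := ENNReal.half_pos hε.ne'
  have hT : Tendsto (fun n => mixedNorm p μ ν (f' - f n)) atTop (𝓝 0) :=
    tendsto_mixedNorm_of_dominated hp0 hp (fun n => hf'.sub (hf n)) hF hFm hle
      fun z => by simpa using (hlim z).const_sub (f' z)
  obtain ⟨n, hn⟩ := (hT.eventually (gt_mem_nhds hε2)).exists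
  obtain ⟨g, hg, hg'⟩ := h n (ε / 2) hε2
  refine ⟨g, hg, ?_⟩
  rw [← sub_add_sub_cancel f' (f n) g, ← ENNReal.add_halves ε]
  exact (mixedNorm_add_le hp1 hp (hf'.sub (hf n))
    ((hf n).sub (measurable_of_mem_rectangleSpan hg))).trans (add_le_add hn.le hg')

variable [IsFiniteMeasure μ] [IsFiniteMeasure ν]

lemma indicator_one (hp1 : 1 ≤ p) (hp : p ≠ ∞) {s : Set (α × γ)} (hs : MeasurableSet s) :
    MixedApproximable p μ ν (s.indicator fun _ => 1) := by
  have hrect : ∀ (a : Set α) (b : Set γ), MeasurableSet a → MeasurableSet b →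
      MixedApproximable p μ ν ((a ×ˢ b).indicator fun _ => 1) := fun a b ha hb =>
    of_mem (Submodule.subset_span ⟨a, b, ha, hb, rfl⟩)
  have hm : ∀ {s : Set (α × γ)}, MeasurableSet s →
      Measurable (s.indicator fun _ => (1 : ℝ)) := fun hs => measurable_const.indicator hs
  induction s, hs using MeasurableSpace.induction_on_inter generateFrom_prod.symm
    isPiSystem_prod with
  | empty => simpa using hrect ∅ ∅ .empty .empty
  | basic s hs =>
    obtain ⟨a, ha, b, hb, rfl⟩ := hs
    exact hrect a b ha hb
  | compl s hs ih =>
    have : (sᶜ.indicator fun _ => (1 : ℝ))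
        = ((Set.univ ×ˢ Set.univ : Set (α × γ)).indicator fun _ => 1)
          + (-1 : ℝ) • s.indicator fun _ => 1 := by
      funext z
      by_cases hz : z ∈ s <;> simp [hz]
    rw [this]
    exact add hp1 hp (hm (.prod .univ .univ)) ((hm hs).const_smul _) (hrect _ _ .univ .univ)
      (ih.const_smul _)
  | iUnion f hd hf ih =>
    have hU : ∀ n, MeasurableSet (⋃ i ∈ Finset.range n, f i) := fun n =>
      Finset.measurableSet_biUnion _ fun i _ => hf i
    refine of_dominated hp1 hp (f := fun n => (⋃ i ∈ Finset.range n, f i).indicator fun _ => 1)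
      (F := fun _ => 1) (fun n => hm (hU n)) (hm (.iUnion hf)) measurable_const
      (mixedNorm_const_lt_top 1) ?_ ?_ ?_
    · intro n z
      have : z ∈ (⋃ i ∈ Finset.range n, f i) → z ∈ ⋃ i, f i := by
        simp only [Set.mem_iUnion]
        exact fun ⟨i, _, hi⟩ => ⟨i, hi⟩
      by_cases h1 : z ∈ (⋃ i ∈ Finset.range n, f i)
      · simp only [Set.indicator_of_mem h1, Set.indicator_of_mem (this h1)]
        simp
      · rw [Set.indicator_of_notMem h1]
        by_cases h2 : z ∈ ⋃ i, f i
        · rw [Set.indicator_of_mem h2]; simp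
        · rw [Set.indicator_of_notMem h2]; simp
    · intro z
      exact ((tendsto_indicator_biUnion_finset f (fun _ => (1 : ℝ)) z).comp
        tendsto_finset_range).mono_right (pure_le_nhds _)
    · intro n
      induction n with
      | zero => simpa using hrect ∅ ∅ .empty .empty
      | succ n ihn =>
        have : ((⋃ i ∈ Finset.range (n + 1), f i).indicator fun _ => (1 : ℝ))
            = ((⋃ i ∈ Finset.range n, f i).indicator fun _ => 1) + (f n).indicator fun _ => 1 := by
          rw [Finset.range_add_one, Finset.set_biUnion_insert, Set.union_comm]
          refine Set.indicator_union_of_disjoint ?_ _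
          simp only [Set.disjoint_iUnion_left]
          exact fun i hi => hd (Finset.mem_range.1 hi).ne
        rw [this]
        exact add hp1 hp (hm (hU n)) (hm (hf n)) ihn (ih n)

lemma of_simpleFunc (hp1 : 1 ≤ p) (hp : p ≠ ∞) (f : SimpleFunc (α × γ) ℝ) :
    MixedApproximable p μ ν f := by
  induction f using SimpleFunc.induction with
  | const c hs =>
    rename_i s
    have : ⇑(SimpleFunc.piecewise s hs (SimpleFunc.const _ c) (SimpleFunc.const _ 0))
        = c • s.indicator fun _ => (1 : ℝ) := by
      funext z
      by_cases hz : z ∈ s <;> simp [hz]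
    rw [this]
    exact (indicator_one hp1 hp hs).const_smul c
  | add _ hf hg =>
    rw [SimpleFunc.coe_add]
    exact add hp1 hp (SimpleFunc.measurable _) (SimpleFunc.measurable _) hf hg

/-- Every measurable kernel of finite mixed norm is a limit of rectangle kernels. -/
lemma of_measurable (hp1 : 1 ≤ p) (hp : p ≠ ∞) {f : α × γ → ℝ} (hf : Measurable f)
    (hfin : mixedNorm p μ ν f < ∞) : MixedApproximable p μ ν f := by
  refine of_dominated hp1 hp
    (f := fun n => SimpleFunc.approxOn f hf Set.univ 0 (Set.mem_univ _) n) (F := (3 : ℝ) • f)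
    (fun n => SimpleFunc.measurable _) hf (hf.const_smul _)
    ((mixedNorm_const_smul_le _ _).trans_lt (ENNReal.mul_lt_top enorm_lt_top hfin)) ?_ ?_
    fun n => of_simpleFunc hp1 hp _
  · intro n z
    have h1 := SimpleFunc.norm_approxOn_zero_le hf (Set.mem_univ _) z n
    have h2 := norm_sub_le (f z) (SimpleFunc.approxOn f hf Set.univ 0 (Set.mem_univ _) n z)
    simp only [Pi.smul_apply, norm_smul, Real.norm_ofNat]
    linarith
  · exact fun z => SimpleFunc.tendsto_approxOn hf _ (by simp)

end MixedApproximable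

end

section Operator

variable {μ : Measure α} {ν : Measure γ} {p q : ℝ≥0∞} [Fact (1 ≤ p)]

/-- A rectangle kernel is the kernel of a compact operator. -/
lemma exists_compact_of_mem_rectangleSpan [IsFiniteMeasure μ] [IsFiniteMeasure ν]
    [Fact (1 ≤ q)] [p.HolderConjugate q] {g : α × γ → ℝ} (hg : g ∈ rectangleSpan α γ) :
    ∃ B : Lp ℝ p μ →L[ℝ] Lp ℝ 2 ν, IsCompactOperator B ∧
      ∀ c : Lp ℝ p μ, (∀ t, Integrable (fun x => g (x, t) * c x) μ) ∧
        ∀ᵐ t ∂ν, B c t = ∫ x, g (x, t) * c x ∂μ := by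
  induction hg using Submodule.span_induction with
  | zero =>
    refine ⟨0, isCompactOperator_zero, fun c => ⟨by simp, ?_⟩⟩
    filter_upwards [Lp.coeFn_zero ℝ 2 ν] with t ht
    simpa using ht
  | add f g _ _ hf hg =>
    obtain ⟨B, hB, hB'⟩ := hf
    obtain ⟨C, hC, hC'⟩ := hg
    refine ⟨B + C, hB.add hC, fun c => ⟨fun t => ?_, ?_⟩⟩
    · simp only [Pi.add_apply, add_mul]
      exact ((hB' c).1 t).add ((hC' c).1 t)
    · filter_upwards [(hB' c).2, (hC' c).2, Lp.coeFn_add (B c) (C c)] with t h1 h2 h3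
      simp only [add_apply, h3, Pi.add_apply, h1, h2, add_mul]
      rw [integral_add ((hB' c).1 t) ((hC' c).1 t)]
  | smul a f _ hf =>
    obtain ⟨B, hB, hB'⟩ := hf
    refine ⟨a • B, hB.smul a, fun c => ⟨fun t => ?_, ?_⟩⟩
    · simpa [mul_assoc] using ((hB' c).1 t).const_mul a
    · filter_upwards [(hB' c).2, Lp.coeFn_smul a (B c)] with t h1 h2
      simp only [smul_apply, h2, Pi.smul_apply, h1, smul_eq_mul, mul_assoc]
      rw [integral_const_mul]
  | mem f hf =>
    obtain ⟨s, b, hs, hb, rfl⟩ := hf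
    let φ : Lp ℝ p μ →L[ℝ] ℝ := ContinuousLinearMap.lpPairing μ q p
      (ContinuousLinearMap.mul ℝ ℝ) (indicatorConstLp q hs (measure_ne_top μ s) (1 : ℝ))
    have hφ : ∀ c, φ c = ∫ x, s.indicator (fun _ => (1 : ℝ)) x * c x ∂μ := by
      intro c
      refine (ContinuousLinearMap.lpPairing_eq_integral _ _ _).trans (integral_congr_ae ?_)
      filter_upwards [indicatorConstLp_coeFn (p := q) (hs := hs) (hμs := measure_ne_top μ s)
        (c := (1 : ℝ))] with x hx
      simp [hx]
    have hprod : ∀ x t, (s ×ˢ b).indicator (fun _ => (1 : ℝ)) (x, t)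
        = b.indicator (fun _ => 1) t * s.indicator (fun _ => 1) x := by
      intro x t
      by_cases hx : x ∈ s <;> by_cases ht : t ∈ b <;> simp [hx, ht]
    let ψ : ℝ →L[ℝ] Lp ℝ 2 ν := ContinuousLinearMap.toSpanSingleton ℝ
      (indicatorConstLp 2 hb (measure_ne_top ν b) (1 : ℝ))
    have hψ : IsCompactOperator ψ := isCompactOperator_of_locallyCompactSpace_rng ψ
    refine ⟨ψ.comp φ, hψ.comp_clm φ, fun c => ⟨fun t => ?_, ?_⟩⟩
    · simp only [hprod, mul_assoc]
      refine Integrable.const_mul ?_ _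
      have hc : Integrable c μ := (Lp.memLp c).integrable Fact.out
      refine (hc.indicator hs).congr (Eventually.of_forall fun x => ?_)
      by_cases hx : x ∈ s <;> simp [hx]
    · filter_upwards [Lp.coeFn_smul (φ c) (indicatorConstLp 2 hb (measure_ne_top ν b) (1 : ℝ)),
        indicatorConstLp_coeFn (p := 2) (hs := hb) (hμs := measure_ne_top ν b)
        (c := (1 : ℝ))] with t h1 h2
      simp only [ψ, ContinuousLinearMap.comp_apply, ContinuousLinearMap.toSpanSingleton_apply, h1,
        Pi.smul_apply, h2, hprod, mul_assoc, integral_const_mul, ← hφ, smul_eq_mul]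
      ring

lemma norm_le_mixedNorm [p.HolderConjugate q] {f : α × γ → ℝ} (hf : Measurable f)
    (hfin : mixedNorm q μ ν f < ∞) (T : Lp ℝ p μ →L[ℝ] Lp ℝ 2 ν)
    (hT : ∀ c : Lp ℝ p μ, ∀ᵐ t ∂ν, T c t = ∫ x, f (x, t) * c x ∂μ) :
    ‖T‖ ≤ (mixedNorm q μ ν f).toReal := by
  refine T.opNorm_le_bound toReal_nonneg fun c => ?_
  have h : ∀ᵐ t ∂ν, ‖T c t‖ₑ ≤ ‖c‖₊ * ‖eLpNorm (fun x => f (x, t)) q μ‖ₑ := by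
    filter_upwards [hT c] with t ht
    rw [ht, enorm_eq_self, mul_comm]
    calc _ ≤ ∫⁻ x, ‖f (x, t) * c x‖ₑ ∂μ := enorm_integral_le_lintegral_enorm _
      _ = eLpNorm ((fun x => f (x, t)) • ⇑c) 1 μ := by
        rw [eLpNorm_one_eq_lintegral_enorm]; rfl
      _ ≤ eLpNorm (fun x => f (x, t)) q μ * eLpNorm c p μ :=
        eLpNorm_smul_le_mul_eLpNorm (Lp.aestronglyMeasurable c)
          (hf.comp measurable_prodMk_right).aestronglyMeasurable
      _ = _ := by rw [← Lp.enorm_def]; rfl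
  have h' := eLpNorm_le_nnreal_smul_eLpNorm_of_ae_le_mul' h 2
  rw [Lp.norm_def, mul_comm]
  refine (toReal_mono ?_ h').trans_eq ?_
  · exact (ENNReal.mul_lt_top coe_lt_top hfin).ne
  · simp [mixedNorm, ENNReal.smul_def]

lemma ae_memLp_section [SFinite μ] (hq0 : q ≠ 0) (hq : q ≠ ∞) {f : α × γ → ℝ} (hf : Measurable f)
    (hfin : mixedNorm q μ ν f < ∞) : ∀ᵐ t ∂ν, MemLp (fun x => f (x, t)) q μ := by
  have h2 := lintegral_rpow_enorm_lt_top_of_eLpNorm_lt_top two_ne_zero ofNat_ne_top hfin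
  filter_upwards [ae_lt_top
    (((measurable_eLpNorm_section hq0 hq hf).enorm).pow_const _) h2.ne] with t ht
  refine ⟨(hf.comp measurable_prodMk_right).aestronglyMeasurable, ?_⟩
  by_contra hcon
  rw [not_lt_top_iff.1 hcon] at ht
  simp at ht

lemma isCompactOperator_of_mixedNorm_lt_top [IsFiniteMeasure μ] [IsFiniteMeasure ν]
    [Fact (1 ≤ q)] [p.HolderConjugate q] (hq : q ≠ ∞) {f : α × γ → ℝ} (hf : Measurable f)
    (hfin : mixedNorm q μ ν f < ∞) (A : Lp ℝ p μ →L[ℝ] Lp ℝ 2 ν)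
    (hA : ∀ c : Lp ℝ p μ, ∀ᵐ t ∂ν, A c t = ∫ x, f (x, t) * c x ∂μ) :
    IsCompactOperator A := by
  have hq1 : 1 ≤ q := Fact.out
  refine isClosed_setOfPred_isCompactOperator.closure_subset
    (Metric.mem_closure_iff.2 fun ε hε => ?_)
  obtain ⟨g, hg, hg'⟩ := MixedApproximable.of_measurable hq1 hq hf hfin
    (ENNReal.ofReal (ε / 2)) (by simpa using hε)
  obtain ⟨B, hB, hB'⟩ := exists_compact_of_mem_rectangleSpan (μ := μ) (ν := ν) (p := p) (q := q) hg
  refine ⟨B, hB, ?_⟩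
  rw [dist_eq_norm]
  refine (norm_le_mixedNorm (hf.sub (measurable_of_mem_rectangleSpan hg))
    (hg'.trans_lt ofReal_lt_top) (A - B) fun c => ?_).trans_lt ?_
  · filter_upwards [hA c, (hB' c).2, Lp.coeFn_sub (A c) (B c),
      ae_memLp_section (zero_lt_one.trans_le hq1).ne' hq hf hfin] with t h1 h2 h3 h4
    have hint : Integrable (fun x => f (x, t) * c x) μ := h4.integrable_mul (Lp.memLp c)
    simp only [sub_apply, h3, Pi.sub_apply, h1, h2, sub_mul]
    rw [integral_sub hint ((hB' c).1 t)]
  · refine (toReal_mono ofReal_ne_top hg').trans_lt ?_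
    rw [toReal_ofReal (by positivity)]
    linarith

end Operator

end MixedNorm

/-- Mixed-norm kernel compactness: for finite measure spaces `(Ω, μ)`, `(I, ν)`,
`1 < l < ∞` with conjugate exponent `l*`, and a measurable kernel `k` with
`∫_I (∫_Ω |k(x,t)|^{l*} dμ)^{2/l*} dν < ∞`, every continuous linear operator
`A : L^l(μ) → L²(ν)` satisfying `(A c)(t) = ∫ k(x,t) c(x) dμ(x)` for `ν`-a.e. `t` is a
compact operator. -/
theorem mixed_norm_kernel_compact {α γ : Type*} [MeasurableSpace α] [MeasurableSpace γ]
    (μ : Measure α) (ν : Measure γ) [IsFiniteMeasure μ] [IsFiniteMeasure ν]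
    (l lstar : ℝ) (hl : 1 < l) (hconj : 1 / l + 1 / lstar = 1)
    (k : α → γ → ℝ) (hk : Measurable (Function.uncurry k))
    (hkint : ∫⁻ t, (∫⁻ x, ENNReal.ofReal |k x t| ^ lstar ∂μ) ^ (2 / lstar) ∂ν < ⊤)
    [Fact (1 ≤ ENNReal.ofReal l)]
    (A : Lp ℝ (ENNReal.ofReal l) μ →L[ℝ] Lp ℝ 2 ν)
    (hA : ∀ c : Lp ℝ (ENNReal.ofReal l) μ, ∀ᵐ t ∂ν, A c t = ∫ x, k x t * c x ∂μ) :
    IsCompactOperator ⇑A := by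
  have hc : l.HolderConjugate lstar := Real.holderConjugate_iff.2 ⟨hl, by simpa using hconj⟩
  have := hc.ennrealOfReal
  have hq1 : 1 < lstar := hc.symm.lt
  have hq0 : 0 < lstar := zero_lt_one.trans hq1
  have : Fact (1 ≤ ENNReal.ofReal lstar) := ⟨by simpa using hq1.le⟩
  refine isCompactOperator_of_mixedNorm_lt_top (q := ENNReal.ofReal lstar) ENNReal.ofReal_ne_top
    hk ?_ A hA
  rw [mixedNorm, eLpNorm_lt_top_iff_lintegral_rpow_enorm_lt_top two_ne_zero ENNReal.ofNat_ne_top]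
  convert hkint using 3 with t
  rw [enorm_eq_self, eLpNorm_eq_lintegral_rpow_enorm_toReal (by simpa using hq0)
    ENNReal.ofReal_ne_top, ENNReal.toReal_ofReal hq0.le, ← ENNReal.rpow_mul]
  simp only [Function.uncurry_apply_pair, Real.enorm_eq_ofReal_abs, ENNReal.toReal_ofNat]
  congr 1
  ring
end
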